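/- For every k ≥ 2, I_p ∩ L_{p,k} = [I_p ∩ L_{p,k−1}, L_{p,1}] + (C_{L_p}(f) ∩ L_{p,k}), where [S, T] denotes the subspace spanned by all brackets [s, t] with s ∈ S, t ∈ T. -/

import Mathlib

namespace Paper

variable (K : Type) [Field K] (p : ℕ)

abbrev Idx (p : ℕ) : Type := (ZMod p)ˣ ⊕ (ZMod p)ˣ

/-- The Lie ideal of the free Lie algebra generated by the `v`-generators. -/
noncomputable def vIdealFree : LieIdeal K (FreeLieAlgebra K (Idx p)) :=
  LieSubmodule.lieSpan K _ (Set.range fun i => FreeLieAlgebra.of K (Sum.inr i : Idx p))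

noncomputable def rels : Set (FreeLieAlgebra K (Idx p)) :=
  { z : FreeLieAlgebra K (Idx p) | ∃ i j : (ZMod p)ˣ,
      z = ⁅FreeLieAlgebra.of K (Sum.inl i : Idx p), FreeLieAlgebra.of K (Sum.inl j : Idx p)⁆ } ∪
  { z : FreeLieAlgebra K (Idx p) | ∃ u ∈ vIdealFree K p, ∃ w ∈ vIdealFree K p, z = ⁅u, w⁆ }

noncomputable def relIdeal : LieIdeal K (FreeLieAlgebra K (Idx p)) :=
  LieSubmodule.lieSpan K _ (rels K p)

abbrev Lp : Type := FreeLieAlgebra K (Idx p) ⧸ relIdeal K p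

noncomputable def gen (x : Idx p) : Lp K p :=
  LieSubmodule.Quotient.mk (N := relIdeal K p) (FreeLieAlgebra.of K x)

noncomputable def aGen (i : (ZMod p)ˣ) : Lp K p := gen K p (Sum.inl i)
noncomputable def vGen (i : (ZMod p)ˣ) : Lp K p := gen K p (Sum.inr i)

/-- Left-normed bracket `[x, l₁, l₂, …]` in the generators. -/
noncomputable def lnb (x : Idx p) (l : List (Idx p)) : Lp K p :=
  l.foldl (fun b y => ⁅b, gen K p y⁆) (gen K p x)

/-- Degree-`k` homogeneous component: the span of left-normed brackets of length `k`. -/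
noncomputable def homog (k : ℕ) : Submodule K (Lp K p) :=
  Submodule.span K { z | ∃ x l, l.length + 1 = k ∧ z = lnb K p x l }

/-- Fixed-point subspace of a Lie algebra automorphism. -/
noncomputable def fixedSubmodule (e : Lp K p ≃ₗ⁅K⁆ Lp K p) : Submodule K (Lp K p) where
  carrier := { x | e x = x }
  add_mem' := by
    intro a b ha hb
    simp only [Set.mem_setOf_eq] at *
    rw [show e (a + b) = e a + e b from map_add e.toLinearEquiv a b, ha, hb]
  zero_mem' := by
    simp only [Set.mem_setOf_eq]
    rw [show e 0 = 0 from map_zero e.toLinearEquiv]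
  smul_mem' := by
    intro c a ha
    simp only [Set.mem_setOf_eq] at *
    rw [show e (c • a) = c • e a from map_smul e.toLinearEquiv c a, ha]

/-- Eigenspace of a Lie algebra automorphism for the eigenvalue `c`. -/
noncomputable def eigSp (e : Lp K p ≃ₗ⁅K⁆ Lp K p) (c : K) : Submodule K (Lp K p) where
  carrier := { x | e x = c • x }
  add_mem' := by
    intro a b ha hb
    simp only [Set.mem_setOf_eq] at *
    rw [show e (a + b) = e a + e b from map_add e.toLinearEquiv a b, ha, hb, smul_add]
  zero_mem' := by
    simp only [Set.mem_setOf_eq]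
    rw [show e 0 = 0 from map_zero e.toLinearEquiv, smul_zero]
  smul_mem' := by
    intro d a ha
    simp only [Set.mem_setOf_eq] at *
    rw [show e (d • a) = d • e a from map_smul e.toLinearEquiv d a, ha, smul_comm]


/-- The Lie ideal of `L_p` generated by the fixed-point subspace of `f`. -/
noncomputable def Ip (K : Type) [Field K] (p : ℕ) (f : Lp K p ≃ₗ⁅K⁆ Lp K p) :
    LieIdeal K (Lp K p) :=
  LieSubmodule.lieSpan K (Lp K p) (fixedSubmodule K p f : Set (Lp K p))

/-- `[S, T]`: the subspace spanned by all brackets `⁅s, t⁆` with `s ∈ S`, `t ∈ T`. -/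
noncomputable def brSpan (K : Type) [Field K] (p : ℕ) (S T : Submodule K (Lp K p)) :
    Submodule K (Lp K p) :=
  Submodule.span K { z : Lp K p | ∃ s ∈ S, ∃ t ∈ T, z = ⁅s, t⁆ }

section Grading

variable {K p}

variable (K p) in
/-- The quotient map `FreeLieAlgebra → Lp` as a Lie algebra homomorphism. -/
noncomputable def proj : FreeLieAlgebra K (Idx p) →ₗ⁅K⁆ Lp K p :=
  { (LieSubmodule.Quotient.mk' (relIdeal K p) : FreeLieAlgebra K (Idx p) →ₗ[K] Lp K p) with
    map_lie' := fun {_ _} => rfl }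

theorem proj_of (x : Idx p) : proj K p (FreeLieAlgebra.of K x) = gen K p x := rfl

theorem proj_surjective : Function.Surjective (proj K p) :=
  LieSubmodule.Quotient.surjective_mk' (relIdeal K p)

theorem proj_eq_zero_iff {x : FreeLieAlgebra K (Idx p)} : proj K p x = 0 ↔ x ∈ relIdeal K p :=
  LieSubmodule.Quotient.mk_eq_zero (N := relIdeal K p)

/-- A Lie subalgebra of a free Lie algebra containing all generators is everything. -/
theorem _root_.FreeLieAlgebra.mem_of_forall_of_mem {R X : Type*} [CommRing R]
    (S : LieSubalgebra R (FreeLieAlgebra R X)) (h : ∀ x, FreeLieAlgebra.of R x ∈ S)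
    (z : FreeLieAlgebra R X) : z ∈ S := by
  have key : S.incl.comp (FreeLieAlgebra.lift R fun x => (⟨FreeLieAlgebra.of R x, h x⟩ : S))
      = LieHom.id := by
    ext x
    simp
  have hz := LieHom.congr_fun key z
  rw [LieHom.id_apply] at hz
  rw [← hz]
  exact Subtype.property _

theorem mem_of_forall_gen_mem (S : LieSubalgebra K (Lp K p)) (h : ∀ x, gen K p x ∈ S)
    (z : Lp K p) : z ∈ S := by
  obtain ⟨z, rfl⟩ := proj_surjective z
  exact FreeLieAlgebra.mem_of_forall_of_mem (S.comap (proj K p)) h z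

/-- A subspace closed under bracketing with generators is closed under all brackets. -/
theorem lie_mem_of_forall_lie_gen_mem (S : Submodule K (Lp K p))
    (h : ∀ s ∈ S, ∀ x, ⁅s, gen K p x⁆ ∈ S) {s : Lp K p} (hs : s ∈ S) (z : Lp K p) :
    ⁅s, z⁆ ∈ S := by
  let N : LieSubalgebra K (Lp K p) :=
    { carrier := {z | ∀ s ∈ S, ⁅s, z⁆ ∈ S}
      add_mem' := fun ha hb s hs => by rw [lie_add]; exact S.add_mem (ha s hs) (hb s hs)
      zero_mem' := fun s _ => by rw [lie_zero]; exact S.zero_mem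
      smul_mem' := fun c a ha s hs => by rw [lie_smul]; exact S.smul_mem c (ha s hs)
      lie_mem' := fun {a b} ha hb s hs => by
        have : ⁅s, ⁅a, b⁆⁆ = ⁅⁅s, a⁆, b⁆ - ⁅⁅s, b⁆, a⁆ := by
          rw [leibniz_lie s a b, ← lie_skew a ⁅s, b⁆, sub_eq_add_neg]
        rw [this]
        exact S.sub_mem (hb _ (ha s hs)) (ha _ (hb s hs)) }
  exact mem_of_forall_gen_mem N (fun x s hs => h s hs x) z s hs

theorem lnb_append_singleton (x : Idx p) (l : List (Idx p)) (y : Idx p) :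
    lnb K p x (l ++ [y]) = ⁅lnb K p x l, gen K p y⁆ := by
  simp [lnb]

theorem lnb_mem_homog (x : Idx p) (l : List (Idx p)) : lnb K p x l ∈ homog K p (l.length + 1) :=
  Submodule.subset_span ⟨x, l, rfl, rfl⟩

theorem gen_mem_homog_one (x : Idx p) : gen K p x ∈ homog K p 1 :=
  lnb_mem_homog x []

theorem homog_zero : homog K p 0 = ⊥ := by
  simp [homog]

theorem homog_one : homog K p 1 = Submodule.span K (Set.range (gen K p)) := by
  refine le_antisymm (Submodule.span_le.2 ?_) (Submodule.span_le.2 ?_)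
  · rintro _ ⟨x, l, hl, rfl⟩
    obtain rfl : l = [] := List.length_eq_zero_iff.1 (by omega)
    exact Submodule.subset_span ⟨x, rfl⟩
  · rintro _ ⟨x, rfl⟩
    exact gen_mem_homog_one x

theorem lie_gen_mem_homog {k : ℕ} {z : Lp K p} (hz : z ∈ homog K p k) (y : Idx p) :
    ⁅z, gen K p y⁆ ∈ homog K p (k + 1) := by
  induction hz using Submodule.span_induction with
  | mem z hz =>
    obtain ⟨x, l, hl, rfl⟩ := hz
    rw [← lnb_append_singleton]
    exact Submodule.subset_span ⟨x, l ++ [y], by simp [hl], rfl⟩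
  | zero => rw [zero_lie]; exact zero_mem _
  | add a b _ _ ha hb => rw [add_lie]; exact add_mem ha hb
  | smul c a _ ha => rw [smul_lie]; exact Submodule.smul_mem _ c ha

theorem lie_mem_homog_succ {k : ℕ} {z t : Lp K p} (hz : z ∈ homog K p k)
    (ht : t ∈ homog K p 1) : ⁅z, t⁆ ∈ homog K p (k + 1) := by
  rw [homog_one] at ht
  induction ht using Submodule.span_induction with
  | mem t ht =>
    obtain ⟨x, rfl⟩ := ht
    exact lie_gen_mem_homog hz x
  | zero => rw [lie_zero]; exact zero_mem _
  | add a b _ _ ha hb => rw [lie_add]; exact add_mem ha hb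
  | smul c a _ ha => rw [lie_smul]; exact Submodule.smul_mem _ c ha

theorem iSup_homog : ⨆ k, homog K p k = ⊤ := by
  have hcl : ∀ s ∈ ⨆ k, homog K p k, ∀ x, ⁅s, gen K p x⁆ ∈ ⨆ k, homog K p k := by
    intro s hs x
    induction hs using Submodule.iSup_induction' with
    | mem k s hs => exact Submodule.mem_iSup_of_mem (k + 1) (lie_gen_mem_homog hs x)
    | zero => rw [zero_lie]; exact zero_mem _
    | add a b _ _ ha hb => rw [add_lie]; exact add_mem ha hb
  let N : LieSubalgebra K (Lp K p) :=
    { (⨆ k, homog K p k : Submodule K (Lp K p)) with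
      lie_mem' := fun {a b} ha _ => lie_mem_of_forall_lie_gen_mem _ hcl ha b }
  exact (Submodule.eq_top_iff').2 fun z => mem_of_forall_gen_mem N
    (fun x => Submodule.mem_iSup_of_mem (p := homog K p) 1 (gen_mem_homog_one x)) z

theorem mem_iSup_homog (z : Lp K p) : z ∈ ⨆ k, homog K p k :=
  (Submodule.eq_top_iff').1 iSup_homog z

open scoped TensorProduct Polynomial

variable (K p) in
/-- The Lie homomorphism out of the free Lie algebra sending each generator `x` to `t ⊗ x`. -/
noncomputable def degreeHomFree : FreeLieAlgebra K (Idx p) →ₗ⁅K⁆ K[X] ⊗[K] Lp K p :=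
  FreeLieAlgebra.lift K fun x => (Polynomial.X : K[X]) ⊗ₜ[K] gen K p x

theorem degreeHomFree_of (x : Idx p) :
    degreeHomFree K p (FreeLieAlgebra.of K x) = (Polynomial.X : K[X]) ⊗ₜ[K] gen K p x :=
  FreeLieAlgebra.lift_of_apply _ x

variable (K p) in
/-- The image in `Lp` of the ideal generated by the `v`-generators. -/
noncomputable def vIdeal : LieIdeal K (Lp K p) :=
  { (vIdealFree K p).toSubmodule.map (proj K p).toLinearMap with
    lie_mem := by
      rintro x _ ⟨m, hm, rfl⟩
      obtain ⟨x, rfl⟩ := proj_surjective x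
      exact ⟨⁅x, m⁆, (vIdealFree K p).lie_mem hm, LieHom.map_lie (proj K p) x m⟩ }

theorem vIdeal_abelian : ⁅vIdeal K p, vIdeal K p⁆ = ⊥ := by
  rw [LieSubmodule.lie_eq_bot_iff]
  rintro _ ⟨u, hu, rfl⟩ _ ⟨w, hw, rfl⟩
  exact (LieHom.map_lie (proj K p) u w).symm.trans
    (proj_eq_zero_iff.2 (LieSubmodule.subset_lieSpan (Or.inr ⟨u, hu, w, hw, rfl⟩)))

theorem degreeHomFree_mem {u : FreeLieAlgebra K (Idx p)} (hu : u ∈ vIdealFree K p) :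
    degreeHomFree K p u ∈ (vIdeal K p).baseChange K[X] := by
  let N : LieIdeal K (FreeLieAlgebra K (Idx p)) :=
    { (((vIdeal K p).baseChange K[X]).toSubmodule.restrictScalars K).comap
        (degreeHomFree K p).toLinearMap with
      lie_mem := by
        intro x m hm
        change degreeHomFree K p ⁅x, m⁆ ∈ (vIdeal K p).baseChange K[X]
        rw [LieHom.map_lie]
        exact LieSubmodule.lie_mem _ hm }
  suffices h : vIdealFree K p ≤ N from h hu
  refine LieSubmodule.lieSpan_le.2 ?_
  rintro _ ⟨i, rfl⟩
  change degreeHomFree K p _ ∈ (vIdeal K p).baseChange K[X]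
  rw [degreeHomFree_of]
  exact LieSubmodule.tmul_mem_baseChange_of_mem _
    ⟨_, LieSubmodule.subset_lieSpan ⟨i, rfl⟩, rfl⟩

theorem relIdeal_le_ker : relIdeal K p ≤ (degreeHomFree K p).ker := by
  refine LieSubmodule.lieSpan_le.2 ?_
  rintro _ (⟨i, j, rfl⟩ | ⟨u, hu, w, hw, rfl⟩)
  · refine (LieHom.mem_ker).2 ?_
    have h : ⁅gen K p (Sum.inl i), gen K p (Sum.inl j)⁆ = 0 := by
      rw [← proj_of, ← proj_of, ← LieHom.map_lie]
      exact proj_eq_zero_iff.2 (LieSubmodule.subset_lieSpan (Or.inl ⟨i, j, rfl⟩))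
    rw [LieHom.map_lie, degreeHomFree_of, degreeHomFree_of,
      LieAlgebra.ExtendScalars.bracket_tmul, h, TensorProduct.tmul_zero]
  · refine (LieHom.mem_ker).2 ?_
    rw [LieHom.map_lie]
    have h := LieSubmodule.lie_mem_lie (degreeHomFree_mem hu) (degreeHomFree_mem hw)
    rwa [← LieSubmodule.lie_baseChange, vIdeal_abelian, LieSubmodule.baseChange_bot,
      LieSubmodule.mem_bot] at h

/-- The linear map on `Lp` multiplying degree `k` elements by `t ^ k`. -/
noncomputable def degreeMap : Lp K p →ₗ[K] K[X] ⊗[K] Lp K p :=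
  (relIdeal K p).toSubmodule.liftQ
    (degreeHomFree K p).toLinearMap
    fun _ hx => (LieHom.mem_ker).1 (relIdeal_le_ker hx)

theorem degreeMap_proj (x : FreeLieAlgebra K (Idx p)) :
    degreeMap (proj K p x) = degreeHomFree K p x :=
  rfl

theorem degreeMap_gen (x : Idx p) :
    degreeMap (gen K p x) = (Polynomial.X : K[X]) ⊗ₜ[K] gen K p x := by
  rw [← proj_of, degreeMap_proj, degreeHomFree_of, proj_of]

theorem degreeMap_lie (x y : Lp K p) : degreeMap ⁅x, y⁆ = ⁅degreeMap x, degreeMap y⁆ := by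
  obtain ⟨x, rfl⟩ := proj_surjective x
  obtain ⟨y, rfl⟩ := proj_surjective y
  rw [← LieHom.map_lie, degreeMap_proj, degreeMap_proj, degreeMap_proj, LieHom.map_lie]

theorem degreeMap_lnb (x : Idx p) (l : List (Idx p)) :
    degreeMap (lnb K p x l) = (Polynomial.X ^ (l.length + 1) : K[X]) ⊗ₜ[K] lnb K p x l := by
  induction l using List.reverseRecOn with
  | nil => simpa [lnb] using degreeMap_gen x
  | append_singleton l y ih =>
    rw [lnb_append_singleton, degreeMap_lie, ih, degreeMap_gen,
      LieAlgebra.ExtendScalars.bracket_tmul, ← pow_succ, List.length_append, List.length_singleton]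

theorem degreeMap_of_mem_homog {k : ℕ} {z : Lp K p} (hz : z ∈ homog K p k) :
    degreeMap z = (Polynomial.X ^ k : K[X]) ⊗ₜ[K] z := by
  induction hz using Submodule.span_induction with
  | mem z hz =>
    obtain ⟨x, l, rfl, rfl⟩ := hz
    exact degreeMap_lnb x l
  | zero => rw [map_zero, TensorProduct.tmul_zero]
  | add a b _ _ ha hb => rw [map_add, ha, hb, TensorProduct.tmul_add]
  | smul c a _ ha => rw [map_smul, ha, TensorProduct.tmul_smul]

/-- The projection of `Lp` onto its degree-`k` component. -/
noncomputable def homogProj (k : ℕ) : Lp K p →ₗ[K] Lp K p :=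
  (TensorProduct.lid K (Lp K p)).toLinearMap ∘ₗ
    (Polynomial.lcoeff K k).rTensor (Lp K p) ∘ₗ degreeMap

theorem homogProj_of_mem {j : ℕ} {z : Lp K p} (hz : z ∈ homog K p j) (k : ℕ) :
    homogProj k z = if k = j then z else 0 := by
  simp only [homogProj, LinearMap.comp_apply, degreeMap_of_mem_homog hz, LinearMap.rTensor_tmul,
    LinearEquiv.coe_coe, TensorProduct.lid_tmul, Polynomial.lcoeff_apply, Polynomial.coeff_X_pow,
    ite_smul, one_smul, zero_smul]

/-- The degree-`k` component of an element of a sum of homogeneous subspaces. -/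
theorem homogProj_mem_of_mem_iSup {S : ℕ → Submodule K (Lp K p)} (hS : ∀ k, S k ≤ homog K p k)
    {z : Lp K p} (hz : z ∈ ⨆ k, S k) (k : ℕ) : homogProj k z ∈ S k := by
  induction hz using Submodule.iSup_induction' with
  | mem j z hz =>
    rw [homogProj_of_mem (hS j hz)]
    split_ifs with h
    · exact h ▸ hz
    · exact zero_mem _
  | zero => rw [map_zero]; exact zero_mem _
  | add a b _ _ ha hb => rw [map_add]; exact add_mem ha hb

theorem homogProj_mem_homog (k : ℕ) (z : Lp K p) : homogProj k z ∈ homog K p k :=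
  homogProj_mem_of_mem_iSup (fun _ => le_rfl) (mem_iSup_homog z) k

/-- An element lies in any subspace containing all its homogeneous components. -/
theorem mem_of_forall_homogProj_mem {S : Submodule K (Lp K p)} {z : Lp K p}
    (h : ∀ k, homogProj k z ∈ S) : z ∈ S := by
  obtain ⟨y, hy, rfl⟩ := (Submodule.mem_iSup_iff_exists_finsupp (homog K p) z).1
    (mem_iSup_homog z)
  refine S.sum_mem fun k hk => ?_
  have hk' := h k
  rw [Finsupp.sum, map_sum, Finset.sum_congr rfl fun j _ => homogProj_of_mem (hy j) k,
    Finset.sum_ite_eq, if_pos hk] at hk'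
  exact hk'

/-- A diagonal automorphism preserves the homogeneous components. -/
theorem map_mem_homog {f : Lp K p ≃ₗ⁅K⁆ Lp K p} {c : Idx p → K}
    (hf : ∀ x, f (gen K p x) = c x • gen K p x) {k : ℕ} {z : Lp K p} (hz : z ∈ homog K p k) :
    f z ∈ homog K p k := by
  have hlnb : ∀ x l, f (lnb K p x l) ∈ homog K p (l.length + 1) := by
    intro x l
    induction l using List.reverseRecOn with
    | nil =>
      rw [show lnb K p x [] = gen K p x from rfl, hf]
      exact Submodule.smul_mem _ _ (gen_mem_homog_one x)
    | append_singleton l y ih =>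
      rw [lnb_append_singleton, LieEquiv.map_lie, hf, lie_smul, List.length_append,
        List.length_singleton]
      exact Submodule.smul_mem _ _ (lie_gen_mem_homog ih y)
  suffices h : homog K p k ≤ (homog K p k).comap f.toLinearEquiv.toLinearMap from h hz
  refine Submodule.span_le.2 ?_
  rintro _ ⟨x, l, rfl, rfl⟩
  exact hlnb x l

theorem homogProj_map {f : Lp K p ≃ₗ⁅K⁆ Lp K p} {c : Idx p → K}
    (hf : ∀ x, f (gen K p x) = c x • gen K p x) (k : ℕ) (z : Lp K p) :
    homogProj k (f z) = f (homogProj k z) := by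
  have hz := mem_iSup_homog z
  have hadd : ∀ a b, f (a + b) = f a + f b := map_add f.toLinearEquiv
  have hzero : f 0 = 0 := map_zero f.toLinearEquiv
  induction hz using Submodule.iSup_induction' with
  | mem j z hz =>
    rw [homogProj_of_mem hz, homogProj_of_mem (map_mem_homog hf hz)]
    split_ifs
    · rfl
    · exact hzero.symm
  | zero => rw [hzero, map_zero, hzero]
  | add a b _ _ ha hb => rw [hadd, map_add, map_add, hadd, ha, hb]

theorem Ip_inter_homog_eq {f : Lp K p ≃ₗ⁅K⁆ Lp K p} {c : Idx p → K}
    (hf : ∀ x, f (gen K p x) = c x • gen K p x) (k : ℕ) :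
    (Ip K p f).toSubmodule ⊓ homog K p k
      = brSpan K p ((Ip K p f).toSubmodule ⊓ homog K p (k - 1)) (homog K p 1)
          ⊔ (fixedSubmodule K p f ⊓ homog K p k) := by
  set J : ℕ → Submodule K (Lp K p) := fun k =>
    brSpan K p ((Ip K p f).toSubmodule ⊓ homog K p (k - 1)) (homog K p 1)
      ⊔ (fixedSubmodule K p f ⊓ homog K p k) with hJ
  have hle : ∀ k, J k ≤ (Ip K p f).toSubmodule ⊓ homog K p k := by
    intro k
    refine sup_le (Submodule.span_le.2 ?_)
      (inf_le_inf_right _ fun x hx => LieSubmodule.subset_lieSpan hx)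
    rintro _ ⟨s, hs, t, ht, rfl⟩
    refine ⟨lie_mem_left K (Lp K p) _ s t hs.1, ?_⟩
    rcases k with _ | k
    · have hs0 : s = 0 := by simpa [homog_zero] using hs.2
      rw [hs0, zero_lie]
      exact zero_mem _
    · exact lie_mem_homog_succ hs.2 ht
  have hcl : ∀ s ∈ ⨆ k, J k, ∀ x, ⁅s, gen K p x⁆ ∈ ⨆ k, J k := by
    intro s hs x
    induction hs using Submodule.iSup_induction' with
    | mem k s hs =>
      exact Submodule.mem_iSup_of_mem (k + 1) (Submodule.mem_sup_left
        (Submodule.subset_span ⟨s, hle k hs, _, gen_mem_homog_one x, rfl⟩))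
    | zero => rw [zero_lie]; exact zero_mem _
    | add a b _ _ ha hb => rw [add_lie]; exact add_mem ha hb
  let N : LieIdeal K (Lp K p) :=
    { (⨆ k, J k : Submodule K (Lp K p)) with
      lie_mem := by
        intro x m hm
        rw [← lie_skew]
        exact neg_mem (lie_mem_of_forall_lie_gen_mem _ hcl hm x) }
  have hN : Ip K p f ≤ N := by
    refine LieSubmodule.lieSpan_le.2 fun z hz => ?_
    refine mem_of_forall_homogProj_mem (S := ⨆ k, J k) fun j => ?_
    refine Submodule.mem_iSup_of_mem j (Submodule.mem_sup_right ⟨?_, homogProj_mem_homog j z⟩)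
    change f _ = _
    rw [← homogProj_map hf, show f z = z from hz]
  refine le_antisymm (fun z hz => ?_) (hle k)
  have h := homogProj_mem_of_mem_iSup (fun k => (hle k).trans inf_le_right) (hN hz.1) k
  rwa [homogProj_of_mem hz.2, if_pos rfl] at h

end Grading

/-- For every `k ≥ 2`,
`I_p ∩ L_{p,k} = [I_p ∩ L_{p,k−1}, L_{p,1}] + (C_{L_p}(f) ∩ L_{p,k})`. -/
theorem Ip_inter_homog_recursion (K : Type) [Field K] (p : ℕ) [Fact p.Prime]
    (hchar : ¬ (ringChar K ∣ p)) (ω : K) (hω : IsPrimitiveRoot ω p)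
    (f : Lp K p ≃ₗ⁅K⁆ Lp K p)
    (hfa : ∀ i : (ZMod p)ˣ, f (aGen K p i) = ω ^ ((i : ZMod p)).val • aGen K p i)
    (hfv : ∀ i : (ZMod p)ˣ, f (vGen K p i) = ω ^ ((i : ZMod p)).val • vGen K p i) :
    ∀ k : ℕ, 2 ≤ k →
      (Ip K p f).toSubmodule ⊓ homog K p k
        = brSpan K p ((Ip K p f).toSubmodule ⊓ homog K p (k - 1)) (homog K p 1)
            ⊔ (fixedSubmodule K p f ⊓ homog K p k) := by
  intro k _
  exact Ip_inter_homog_eq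
    (c := Sum.elim (fun i => ω ^ (i : ZMod p).val) fun i => ω ^ (i : ZMod p).val)
    (fun x => x.rec hfa hfv) k

end Paper
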